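/- Let O ⊆ Ω₀ = {(z,w) ∈ ℂ × ℂ : z·w ≠ 1} be a nonempty open connected set and let T = (T₁, T₂) : O → Ω₀ be holomorphic. Assume that for every holomorphic function F : Ω₀ → ℂ and every (z,w) ∈ O, (1 − zw)² · ∂_z∂_w(F ∘ T)(z,w) = (1 − T₁(z,w)T₂(z,w))² · (∂₁∂₂F)(T(z,w)). Then there exist a,b,c,d ∈ ℂ with ad − bc ≠ 0 such that either T(z,w) = ((az+b)/(cz+d), (dw+c)/(bw+a)) for all (z,w) ∈ O (with cz+d ≠ 0 and bw+a ≠ 0 on O), or T(z,w) = ((aw+b)/(cw+d), (dz+c)/(bz+a)) for all (z,w) ∈ O. -/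

import Mathlib

open Complex

/-- The affine chart of the complement of the complexified unit circle. -/
def Omega0 : Set (ℂ × ℂ) := {p | p.1 * p.2 ≠ 1}

/-- The mixed second complex partial derivative ∂_z∂_w F of F : ℂ × ℂ → ℂ. -/
noncomputable def mixedDeriv (F : ℂ × ℂ → ℂ) (p : ℂ × ℂ) : ℂ :=
  deriv (fun z => deriv (fun w => F (z, w)) p.2) p.1

open Metric Filter Topology

/-- The partial derivative of `F` in the first variable. -/
noncomputable def derivFst (F : ℂ × ℂ → ℂ) (p : ℂ × ℂ) : ℂ :=
  deriv (fun z => F (z, p.2)) p.1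

/-- The partial derivative of `F` in the second variable. -/
noncomputable def derivSnd (F : ℂ × ℂ → ℂ) (p : ℂ × ℂ) : ℂ :=
  deriv (fun w => F (p.1, w)) p.2

section Regularity

variable {O : Set (ℂ × ℂ)} {f g : ℂ × ℂ → ℂ} {p : ℂ × ℂ}

lemma hasDerivAt_derivFst (hO : IsOpen O) (hf : DifferentiableOn ℂ f O) (hp : p ∈ O) :
    HasDerivAt (fun z => f (z, p.2)) (derivFst f p) p.1 := by
  have h : DifferentiableAt ℂ f (p.1, p.2) := hf.differentiableAt (hO.mem_nhds hp)
  exact (h.comp p.1 (f := fun z : ℂ => (z, p.2)) (by fun_prop)).hasDerivAt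

lemma hasDerivAt_derivSnd (hO : IsOpen O) (hf : DifferentiableOn ℂ f O) (hp : p ∈ O) :
    HasDerivAt (fun w => f (p.1, w)) (derivSnd f p) p.2 := by
  have h : DifferentiableAt ℂ f (p.1, p.2) := hf.differentiableAt (hO.mem_nhds hp)
  exact (h.comp p.2 (f := fun w : ℂ => (p.1, w)) (by fun_prop)).hasDerivAt

lemma exists_polydisc_subset (hO : IsOpen O) (hp : p ∈ O) :
    ∃ r > 0, ∀ z ∈ ball p.1 r, ∀ w ∈ ball p.2 r, (z, w) ∈ O := by
  obtain ⟨r, hr, h⟩ := Metric.isOpen_iff.1 hO p hp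
  refine ⟨r, hr, fun z hz w hw => h ?_⟩
  rw [← Prod.mk.eta (p := p), ← ball_prod_same]
  exact ⟨hz, hw⟩

lemma continuousAt_derivSnd (hO : IsOpen O) (hf : DifferentiableOn ℂ f O) (hp : p ∈ O) :
    ContinuousAt (derivSnd f) p := by
  obtain ⟨r, hr, hb⟩ := exists_polydisc_subset hO hp
  have hlim : TendstoLocallyUniformlyOn (fun (q : ℂ × ℂ) w => f (q.1, w))
      (fun w => f (p.1, w)) (𝓝 p) (ball p.2 r) := by
    rw [Metric.tendstoLocallyUniformlyOn_iff]
    intro ε hε w hw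
    have hc : ContinuousAt f (p.1, w) :=
      hf.continuousOn.continuousAt (hO.mem_nhds (hb _ (mem_ball_self hr) w hw))
    obtain ⟨δ, hδ, h⟩ := Metric.continuousAt_iff.1 hc (ε / 2) (half_pos hε)
    refine ⟨ball w δ, mem_nhdsWithin_of_mem_nhds (ball_mem_nhds w hδ), ?_⟩
    filter_upwards [ball_mem_nhds p hδ] with q hq v hv
    have hq1 : dist q.1 p.1 < δ := (le_max_left _ _).trans_lt hq
    have h1 := @h (p.1, v) (by simpa [Prod.dist_eq, hδ] using hv)
    have h2 := @h (q.1, v) (by simpa [Prod.dist_eq] using And.intro hq1 hv)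
    linarith [dist_triangle_right (f (p.1, v)) (f (q.1, v)) (f (p.1, w))]
  have hd : ∀ z ∈ ball p.1 r, DifferentiableOn ℂ (fun w => f (z, w)) (ball p.2 r) :=
    fun z hz w hw =>
      (hasDerivAt_derivSnd hO hf (hb z hz w hw)).differentiableAt.differentiableWithinAt
  have hev : ∀ᶠ q : ℂ × ℂ in 𝓝 p, DifferentiableOn ℂ (fun w => f (q.1, w)) (ball p.2 r) :=
    (continuous_fst.continuousAt.eventually (ball_mem_nhds p.1 hr)).mono fun q hq => hd _ hq
  have hderiv := hlim.deriv hev isOpen_ball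
  have hcont : ContinuousWithinAt (deriv fun w => f (p.1, w)) (ball p.2 r) p.2 :=
    ((hd _ (mem_ball_self hr)).deriv isOpen_ball).continuousOn _ (mem_ball_self hr)
  refine hderiv.tendsto_comp hcont (mem_ball_self hr) (g := Prod.snd) ?_
  rw [isOpen_ball.nhdsWithin_eq (mem_ball_self hr)]
  exact continuous_snd.continuousAt

lemma differentiableAt_derivSnd (hO : IsOpen O) (hf : DifferentiableOn ℂ f O) (hp : p ∈ O) :
    DifferentiableAt ℂ (fun z => derivSnd f (z, p.2)) p.1 := by
  obtain ⟨r, hr, hb⟩ := exists_polydisc_subset hO hp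
  have hlim : TendstoLocallyUniformlyOn (fun h z => (f (z, p.2 + h) - f (z, p.2)) / h)
      (fun z => derivSnd f (z, p.2)) (𝓝[≠] (0 : ℂ)) (ball p.1 r) := by
    rw [Metric.tendstoLocallyUniformlyOn_iff]
    intro ε hε z hz
    obtain ⟨δ, hδ, h⟩ := Metric.continuousAt_iff.1
      (continuousAt_derivSnd hO hf (hb z hz _ (mem_ball_self hr))) (ε / 4) (by positivity)
    refine ⟨ball z δ ∩ ball p.1 r, inter_mem (mem_nhdsWithin_of_mem_nhds (ball_mem_nhds z hδ))
      self_mem_nhdsWithin, ?_⟩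
    filter_upwards [mem_nhdsWithin_of_mem_nhds (ball_mem_nhds (0 : ℂ) (lt_min hδ hr)),
      self_mem_nhdsWithin] with t ht ht0 y hy
    have ht0 : t ≠ 0 := ht0
    have hy1 : dist y z < δ := hy.1
    have htm : ‖t‖ < min δ r := by simpa using ht
    have key := (convex_ball p.2 (min δ r)).norm_image_sub_le_of_norm_hasDerivWithin_le
      (f := fun w => f (y, w) - derivSnd f (y, p.2) * w)
      (f' := fun w => derivSnd f (y, w) - derivSnd f (y, p.2)) (C := ε / 2)
      (x := p.2) (y := p.2 + t)
      (fun w hw => by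
        have h1 := hasDerivAt_derivSnd hO hf
          (hb y hy.2 w (ball_subset_ball (min_le_right _ _) hw))
        have h2 := h1.sub ((hasDerivAt_id w).const_mul (derivSnd f (y, p.2)))
        rw [mul_one] at h2
        exact h2.hasDerivWithinAt)
      (fun w hw => by
        have hw' : dist w p.2 < δ := lt_of_lt_of_le hw (min_le_left _ _)
        have h1 := @h (y, w) (by simpa [Prod.dist_eq] using And.intro hy1 hw')
        have h2 := @h (y, p.2) (by simpa [Prod.dist_eq, hδ] using hy1)
        rw [← dist_eq_norm]
        linarith [dist_triangle_right (derivSnd f (y, w)) (derivSnd f (y, p.2))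
          (derivSnd f (z, p.2))])
      (mem_ball_self (lt_min hδ hr)) (by simpa using htm)
    have htpos : 0 < ‖t‖ := norm_pos_iff.2 ht0
    rw [dist_comm, dist_eq_norm]
    have heq : (f (y, p.2 + t) - f (y, p.2)) / t - derivSnd f (y, p.2)
        = ((f (y, p.2 + t) - derivSnd f (y, p.2) * (p.2 + t))
          - (f (y, p.2) - derivSnd f (y, p.2) * p.2)) / t := by
      field_simp
      ring
    rw [heq, norm_div, div_lt_iff₀ htpos]
    simp only [add_sub_cancel_left] at key
    nlinarith
  refine (hlim.differentiableOn ?_ isOpen_ball).differentiableAt (ball_mem_nhds p.1 hr)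
  filter_upwards [mem_nhdsWithin_of_mem_nhds (ball_mem_nhds (0 : ℂ) hr)] with t ht z hz
  have h1 := hasDerivAt_derivFst hO hf (hb z hz (p.2 + t) (by simpa using ht))
  have h2 := hasDerivAt_derivFst hO hf (hb z hz p.2 (mem_ball_self hr))
  exact ((h1.sub h2).div_const t).differentiableAt.differentiableWithinAt

lemma mixedDeriv_mul (hO : IsOpen O) (hf : DifferentiableOn ℂ f O)
    (hg : DifferentiableOn ℂ g O) (hp : p ∈ O) :
    mixedDeriv (fun q => f q * g q) p = mixedDeriv f p * g p + derivSnd f p * derivFst g p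
      + (derivFst f p * derivSnd g p + f p * mixedDeriv g p) := by
  obtain ⟨r, hr, hb⟩ := exists_polydisc_subset hO hp
  have hev : (fun z => deriv (fun w => f (z, w) * g (z, w)) p.2) =ᶠ[𝓝 p.1]
      fun z => derivSnd f (z, p.2) * g (z, p.2) + f (z, p.2) * derivSnd g (z, p.2) := by
    filter_upwards [ball_mem_nhds p.1 hr] with z hz
    have hq := hb z hz p.2 (mem_ball_self hr)
    exact ((hasDerivAt_derivSnd hO hf hq).mul (hasDerivAt_derivSnd hO hg hq)).deriv
  have h1 := (differentiableAt_derivSnd hO hf hp).hasDerivAt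
  have h2 := (differentiableAt_derivSnd hO hg hp).hasDerivAt
  have h3 := hasDerivAt_derivFst hO hf hp
  have h4 := hasDerivAt_derivFst hO hg hp
  exact hev.deriv_eq.trans ((h1.mul h4).add (h3.mul h2)).deriv

end Regularity

section Separation

variable {φ γ : ℂ → ℂ} {z₀ w₀ : ℂ}

/-- Differentiating the separated functional equation in `w` determines `φ` as a Möbius
transformation. -/
lemma exists_moebius_of_separated {U : Set ℂ} (hγ : ∀ᶠ w in 𝓝 w₀, DifferentiableAt ℂ γ w)
    (hγ₀ : deriv γ w₀ ≠ 0) (hzw : ∀ z ∈ U, 1 - z * w₀ ≠ 0)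
    (hne : ∀ z ∈ U, 1 - φ z * γ w₀ ≠ 0)
    (h : ∀ z ∈ U, ∀ᶠ w in 𝓝 w₀,
      deriv φ z * deriv γ w * (1 - z * w) ^ 2 = (1 - φ z * γ w) ^ 2) :
    ∃ a b c d : ℂ, a * d - b * c ≠ 0 ∧ ∀ z ∈ U, φ z * (c * z + d) = a * z + b := by
  have hγd : DifferentiableAt ℂ (deriv γ) w₀ :=
    (analyticAt_iff_eventually_differentiableAt.2 hγ).deriv.differentiableAt
  set A := deriv (deriv γ) w₀ with hA
  set B := deriv γ w₀ with hB
  refine ⟨-(A * w₀ + 2 * B), A, γ w₀ * (-(A * w₀ + 2 * B)) + 2 * B ^ 2 * w₀,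
    γ w₀ * A - 2 * B ^ 2, ?_, fun z hz => ?_⟩
  · have : (4 : ℂ) * B ^ 3 ≠ 0 := by simpa using hγ₀
    convert this using 1
    ring
  · have hlin : HasDerivAt (fun w : ℂ => 1 - z * w) (-z) w₀ := by
      simpa using ((hasDerivAt_id w₀).const_mul z).const_sub 1
    have hl := ((hγd.hasDerivAt.const_mul (deriv φ z)).mul (hlin.pow 2))
    have hr := (((hγ.self_of_nhds.hasDerivAt).const_mul (φ z)).const_sub 1).pow 2
    have e1 := hl.unique (hr.congr_of_eventuallyEq (h z hz))
    have e0 := (h z hz).self_of_nhds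
    rw [← hA, ← hB] at e1
    rw [← hB] at e0
    simp only [Nat.cast_ofNat, Nat.add_one_sub_one, pow_one, Pi.pow_apply] at e1
    have h1 := hne z hz
    have h2 := hzw z hz
    apply mul_left_cancel₀ h1
    linear_combination (-B * (1 - z * w₀)) * e1 + (A * (1 - z * w₀) - 2 * z * B) * e0

lemma eq_of_separated_of_moebius {a b c d w B C : ℂ} (hdet : a * d - b * c ≠ 0)
    (hφ : ∀ᶠ z in 𝓝 z₀, DifferentiableAt ℂ φ z)
    (hm : ∀ᶠ z in 𝓝 z₀, φ z * (c * z + d) = a * z + b)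
    (hB : B ≠ 0) (hzw : 1 - z₀ * w ≠ 0)
    (h : ∀ᶠ z in 𝓝 z₀, deriv φ z * B * (1 - z * w) ^ 2 = (1 - φ z * C) ^ 2) :
    C * (b * w + a) = d * w + c := by
  have hφ' : ∀ᶠ z in 𝓝 z₀, deriv φ z * (c * z + d) ^ 2 = a * d - b * c := by
    filter_upwards [hφ, hm, hm.eventually_nhds] with z hz hmz hmz'
    have hl1 : HasDerivAt (fun z : ℂ => c * z + d) c z := by
      simpa using ((hasDerivAt_id z).const_mul c).add_const d
    have hl2 : HasDerivAt (fun z : ℂ => a * z + b) a z := by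
      simpa using ((hasDerivAt_id z).const_mul a).add_const b
    have e := (hz.hasDerivAt.mul hl1).unique (hl2.congr_of_eventuallyEq hmz')
    linear_combination (c * z + d) * e - c * hmz
  have hsq : ∀ᶠ z in 𝓝 z₀, (a * d - b * c) * B * (1 - z * w) ^ 2
      = ((c - C * a) * z + (d - C * b)) ^ 2 := by
    filter_upwards [hφ', hm, h] with z h1 h2 h3
    have : ((c - C * a) * z + (d - C * b)) = (1 - φ z * C) * (c * z + d) := by
      linear_combination C * h2
    rw [this, mul_pow, ← h3, ← h1]
    ring
  have hl1 : HasDerivAt (fun z : ℂ => 1 - z * w) (-w) z₀ := by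
    simpa using ((hasDerivAt_id z₀).mul_const w).const_sub 1
  have hl2 : HasDerivAt (fun z : ℂ => (c - C * a) * z + (d - C * b)) (c - C * a) z₀ := by
    simpa using ((hasDerivAt_id z₀).const_mul (c - C * a)).add_const (d - C * b)
  have e1 := ((hl1.pow 2).const_mul ((a * d - b * c) * B)).unique
    ((hl2.pow 2).congr_of_eventuallyEq hsq)
  have e0 := hsq.self_of_nhds
  simp only [Nat.cast_ofNat, Nat.add_one_sub_one, pow_one] at e1
  have hL : (c - C * a) * z₀ + (d - C * b) ≠ 0 := by
    intro h0
    rw [h0, zero_pow two_ne_zero] at e0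
    exact mul_ne_zero (mul_ne_zero hdet hB) (pow_ne_zero 2 hzw) e0
  apply mul_left_cancel₀ (mul_ne_zero two_ne_zero hL)
  linear_combination (1 - z₀ * w) * e1 + 2 * w * e0

end Separation

lemma eq_of_derivSnd_eq_zero {O : Set (ℂ × ℂ)} {f : ℂ × ℂ → ℂ} (hO : IsOpen O)
    (hf : DifferentiableOn ℂ f O) (h0 : ∀ p ∈ O, derivSnd f p = 0) {z w w₀ : ℂ} {r : ℝ}
    (hb : ∀ v ∈ ball w₀ r, (z, v) ∈ O) (hw : w ∈ ball w₀ r) : f (z, w) = f (z, w₀) := by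
  refine isOpen_ball.is_const_of_deriv_eq_zero (convex_ball w₀ r).isPreconnected
    (f := fun v => f (z, v)) (fun v hv => ?_) (fun v hv => h0 _ (hb v hv)) hw
    (mem_ball_self (pos_of_mem_ball hw))
  exact (hasDerivAt_derivSnd hO hf (hb v hv)).differentiableAt.differentiableWithinAt

lemma eq_of_derivFst_eq_zero {O : Set (ℂ × ℂ)} {f : ℂ × ℂ → ℂ} (hO : IsOpen O)
    (hf : DifferentiableOn ℂ f O) (h0 : ∀ p ∈ O, derivFst f p = 0) {z w z₀ : ℂ} {r : ℝ}
    (hb : ∀ v ∈ ball z₀ r, (v, w) ∈ O) (hz : z ∈ ball z₀ r) : f (z, w) = f (z₀, w) := by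
  refine isOpen_ball.is_const_of_deriv_eq_zero (convex_ball z₀ r).isPreconnected
    (f := fun v => f (v, w)) (fun v hv => ?_) (fun v hv => h0 _ (hb v hv)) hz
    (mem_ball_self (pos_of_mem_ball hz))
  exact (hasDerivAt_derivFst hO hf (hb v hv)).differentiableAt.differentiableWithinAt

/-- Identity theorem for holomorphic functions that locally depend on the first variable only. -/
lemma eq_zero_of_derivSnd_eq_zero {O : Set (ℂ × ℂ)} {N : ℂ × ℂ → ℂ} {p₀ : ℂ × ℂ}
    (hO : IsOpen O) (hOc : IsPreconnected O) (hN : DifferentiableOn ℂ N O)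
    (h0 : ∀ p ∈ O, derivSnd N p = 0) (hp₀ : p₀ ∈ O) (hloc : ∀ᶠ p in 𝓝 p₀, N p = 0) :
    ∀ p ∈ O, N p = 0 := by
  suffices O ⊆ {p | ∀ᶠ q in 𝓝 p, N q = 0} from fun p hp => (this hp).self_of_nhds
  refine hOc.subset_of_closure_inter_subset isOpen_setOfPred_eventually_nhds ⟨p₀, hp₀, hloc⟩ ?_
  rintro p ⟨hpc, hp⟩
  obtain ⟨r, hr, hb⟩ := exists_polydisc_subset hO hp
  obtain ⟨q, hq, hqp⟩ := Metric.mem_closure_iff.1 hpc r hr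
  have hq1 : q.1 ∈ ball p.1 r := by
    rw [mem_ball, dist_comm]
    exact (le_max_left _ _).trans_lt hqp
  have hq2 : q.2 ∈ ball p.2 r := by
    rw [mem_ball, dist_comm]
    exact (le_max_right _ _).trans_lt hqp
  have hconst : ∀ z ∈ ball p.1 r, ∀ w ∈ ball p.2 r, N (z, w) = N (z, p.2) :=
    fun z hz w hw => eq_of_derivSnd_eq_zero hO hN h0 (hb z hz) hw
  have han : AnalyticOnNhd ℂ (fun z => N (z, q.2)) (ball p.1 r) :=
    DifferentiableOn.analyticOnNhd (fun z hz =>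
      (hasDerivAt_derivFst hO hN (hb z hz _ hq2)).differentiableAt.differentiableWithinAt)
      isOpen_ball
  have hqz : (fun z => N (z, q.2)) =ᶠ[𝓝 q.1] 0 := by
    have : Tendsto (fun z : ℂ => (z, q.2)) (𝓝 q.1) (𝓝 q) :=
      (by fun_prop : Continuous fun z : ℂ => (z, q.2)).tendsto' _ _ rfl
    exact this.eventually hq
  have hz := han.eqOn_zero_of_preconnected_of_eventuallyEq_zero
    (convex_ball p.1 r).isPreconnected hq1 hqz
  filter_upwards [(isOpen_ball.prod isOpen_ball).mem_nhds
    (⟨mem_ball_self hr, mem_ball_self hr⟩ : p ∈ ball p.1 r ×ˢ ball p.2 r)] with x hx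
  have h1 : N (x.1, q.2) = 0 := hz hx.1
  rw [← Prod.mk.eta (p := x), hconst _ hx.1 _ hx.2, ← hconst _ hx.1 _ hq2, h1]

lemma exists_moebius_of_derivSnd_eq_zero {O : Set (ℂ × ℂ)} {f g : ℂ × ℂ → ℂ}
    (hO : IsOpen O) (hOc : IsConnected O) (hOΩ : O ⊆ Omega0)
    (hf : DifferentiableOn ℂ f O) (hg : DifferentiableOn ℂ g O)
    (hfg : ∀ p ∈ O, 1 - f p * g p ≠ 0)
    (hfw : ∀ p ∈ O, derivSnd f p = 0) (hgz : ∀ p ∈ O, derivFst g p = 0)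
    (h : ∀ p ∈ O, derivFst f p * derivSnd g p * (1 - p.1 * p.2) ^ 2 = (1 - f p * g p) ^ 2) :
    ∃ a b c d : ℂ, a * d - b * c ≠ 0 ∧ ∀ p ∈ O, (c * p.1 + d ≠ 0 ∧ b * p.2 + a ≠ 0) ∧
      f p = (a * p.1 + b) / (c * p.1 + d) ∧ g p = (d * p.2 + c) / (b * p.2 + a) := by
  have hzw : ∀ p ∈ O, 1 - p.1 * p.2 ≠ 0 := fun p hp => sub_ne_zero.2 (Ne.symm (hOΩ hp))
  have hgw : ∀ p ∈ O, derivSnd g p ≠ 0 := fun p hp h0 => by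
    have := h p hp
    rw [h0, mul_zero, zero_mul] at this
    exact pow_ne_zero 2 (hfg p hp) this.symm
  have hsep : ∀ p ∈ O, ∀ r, (∀ z ∈ ball p.1 r, ∀ w ∈ ball p.2 r, (z, w) ∈ O) →
      ∀ z ∈ ball p.1 r, ∀ w ∈ ball p.2 r,
        deriv (fun z => f (z, p.2)) z * deriv (fun w => g (p.1, w)) w * (1 - z * w) ^ 2
          = (1 - f (z, p.2) * g (p.1, w)) ^ 2 := by
    intro p hp r hb z hz w hw
    have hf' : ∀ x ∈ ball p.1 r, f (x, w) = f (x, p.2) := fun x hx =>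
      eq_of_derivSnd_eq_zero hO hf hfw (hb x hx) hw
    have hg' : ∀ y ∈ ball p.2 r, g (z, y) = g (p.1, y) := fun y hy =>
      eq_of_derivFst_eq_zero hO hg hgz (fun x hx => hb x hx y hy) hz
    have e1 : derivFst f (z, w) = deriv (fun z => f (z, p.2)) z :=
      EventuallyEq.deriv_eq ((isOpen_ball.eventually_mem hz).mono hf')
    have e2 : derivSnd g (z, w) = deriv (fun w => g (p.1, w)) w :=
      EventuallyEq.deriv_eq ((isOpen_ball.eventually_mem hw).mono hg')
    have := h (z, w) (hb z hz w hw)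
    rwa [e1, e2, hf' z hz, hg' w hw] at this
  obtain ⟨p₀, hp₀⟩ := hOc.nonempty
  obtain ⟨a, b, c, d, hdet, hm⟩ : ∃ a b c d : ℂ, a * d - b * c ≠ 0 ∧
      ∀ p ∈ O, f p * (c * p.1 + d) - (a * p.1 + b) = 0 := by
    obtain ⟨r, hr, hb⟩ := exists_polydisc_subset hO hp₀
    have hs := mem_ball_self (x := p₀.2) hr
    have hs1 := mem_ball_self (x := p₀.1) hr
    have hgp : ∀ z ∈ ball p₀.1 r, g (z, p₀.2) = g p₀ := fun z hz =>
      eq_of_derivFst_eq_zero hO hg hgz (fun x hx => hb x hx _ hs) hz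
    obtain ⟨a, b, c, d, hdet, hm⟩ := exists_moebius_of_separated (U := ball p₀.1 r)
      (φ := fun z => f (z, p₀.2)) (γ := fun w => g (p₀.1, w)) (w₀ := p₀.2)
      ((isOpen_ball.eventually_mem hs).mono fun w hw =>
        (hasDerivAt_derivSnd hO hg (hb _ hs1 w hw)).differentiableAt)
      (hgw p₀ hp₀) (fun z hz => hzw _ (hb z hz _ hs))
      (fun z hz => by simpa [hgp z hz] using hfg _ (hb z hz _ hs))
      (fun z hz => (isOpen_ball.eventually_mem hs).mono fun w hw =>
        hsep p₀ hp₀ r hb z hz w hw)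
    refine ⟨a, b, c, d, hdet, eq_zero_of_derivSnd_eq_zero hO hOc.isPreconnected
      (by fun_prop) (fun p hp => ?_) hp₀ ?_⟩
    · have h1 := ((hasDerivAt_derivSnd hO hf hp).mul_const (c * p.1 + d)).sub_const
        (a * p.1 + b)
      rw [hfw p hp, zero_mul] at h1
      exact h1.deriv
    · filter_upwards [(isOpen_ball.prod isOpen_ball).mem_nhds
        (⟨hs1, hs⟩ : p₀ ∈ ball p₀.1 r ×ˢ ball p₀.2 r)] with x hx
      rw [← hm x.1 hx.1, ← eq_of_derivSnd_eq_zero hO hf hfw (hb x.1 hx.1) hx.2, sub_self]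
  refine ⟨a, b, c, d, hdet, fun p hp => ?_⟩
  have hfp : f p * (c * p.1 + d) = a * p.1 + b := sub_eq_zero.1 (hm p hp)
  have hgp : g p * (b * p.2 + a) = d * p.2 + c := by
    obtain ⟨r, hr, hb⟩ := exists_polydisc_subset hO hp
    have hs := mem_ball_self (x := p.2) hr
    have hev := isOpen_ball.eventually_mem (mem_ball_self (x := p.1) hr)
    exact eq_of_separated_of_moebius (φ := fun z => f (z, p.2)) hdet
      (hev.mono fun z hz => (hasDerivAt_derivFst hO hf (hb z hz _ hs)).differentiableAt)
      (hev.mono fun z hz => sub_eq_zero.1 (hm _ (hb z hz _ hs))) (hgw p hp) (hzw p hp)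
      (hev.mono fun z hz => hsep p hp r hb z hz _ hs)
  have hc : c * p.1 + d ≠ 0 := fun h0 => hdet <| by
    rw [h0, mul_zero] at hfp
    linear_combination a * h0 + c * hfp
  have hb : b * p.2 + a ≠ 0 := fun h0 => hdet <| by
    rw [h0, mul_zero] at hgp
    linear_combination d * h0 + b * hgp
  exact ⟨⟨hc, hb⟩, (eq_div_iff hc).2 hfp, (eq_div_iff hb).2 hgp⟩

/-- the maps leaving the canonical Laplacian (1−zw)²∂_z∂_w on Ω₀ invariant
belong to the Möbius subgroup: T(z,w) = (ψ(z), 1/ψ(1/w)) or T(z,w) = (ψ(w), 1/ψ(1/z))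
for a Möbius transformation ψ(z) = (az+b)/(cz+d), where 1/ψ(1/w) = (dw+c)/(bw+a). -/
theorem laplacian_invariance_implies_moebius_omega
    (O : Set (ℂ × ℂ)) (hO : IsOpen O) (hOc : IsConnected O) (hOΩ : O ⊆ Omega0)
    (T₁ T₂ : ℂ × ℂ → ℂ)
    (hT₁ : DifferentiableOn ℂ T₁ O) (hT₂ : DifferentiableOn ℂ T₂ O)
    (hTmaps : ∀ p ∈ O, ((T₁ p, T₂ p) : ℂ × ℂ) ∈ Omega0)
    (hinv : ∀ F : ℂ × ℂ → ℂ, DifferentiableOn ℂ F Omega0 →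
      ∀ p ∈ O, (1 - p.1 * p.2) ^ 2 * mixedDeriv (fun q => F (T₁ q, T₂ q)) p
        = (1 - T₁ p * T₂ p) ^ 2 * mixedDeriv F (T₁ p, T₂ p)) :
    ∃ a b c d : ℂ, a * d - b * c ≠ 0 ∧
      ((∀ p ∈ O, (c * p.1 + d ≠ 0 ∧ b * p.2 + a ≠ 0) ∧
          T₁ p = (a * p.1 + b) / (c * p.1 + d) ∧
          T₂ p = (d * p.2 + c) / (b * p.2 + a)) ∨
       (∀ p ∈ O, (c * p.2 + d ≠ 0 ∧ b * p.1 + a ≠ 0) ∧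
          T₁ p = (a * p.2 + b) / (c * p.2 + d) ∧
          T₂ p = (d * p.1 + c) / (b * p.1 + a))) := by
  have hfst : DifferentiableOn ℂ (fun q : ℂ × ℂ => q.1) Set.univ := by fun_prop
  have hsnd : DifferentiableOn ℂ (fun q : ℂ × ℂ => q.2) Set.univ := by fun_prop
  have hzw : ∀ p ∈ O, 1 - p.1 * p.2 ≠ 0 := fun p hp => sub_ne_zero.2 (Ne.symm (hOΩ hp))
  have hTT : ∀ p ∈ O, 1 - T₁ p * T₂ p ≠ 0 := fun p hp => sub_ne_zero.2 (Ne.symm (hTmaps p hp))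
  have m1 : ∀ p ∈ O, mixedDeriv T₁ p = 0 := fun p hp => by
    have := hinv (fun q => q.1) (by fun_prop) p hp
    simpa [mixedDeriv, hzw p hp] using this
  have m2 : ∀ p ∈ O, mixedDeriv T₂ p = 0 := fun p hp => by
    have := hinv (fun q => q.2) (by fun_prop) p hp
    simpa [mixedDeriv, hzw p hp] using this
  have h11 : ∀ p ∈ O, derivSnd T₁ p * derivFst T₁ p = 0 := fun p hp => by
    have := hinv (fun q => q.1 * q.1) (by fun_prop) p hp
    rw [mixedDeriv_mul hO hT₁ hT₁ hp, mixedDeriv_mul isOpen_univ hfst hfst (Set.mem_univ _),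
      m1 p hp] at this
    simp [mixedDeriv, derivFst, derivSnd, hzw p hp] at this ⊢
    grind
  have h22 : ∀ p ∈ O, derivSnd T₂ p * derivFst T₂ p = 0 := fun p hp => by
    have := hinv (fun q => q.2 * q.2) (by fun_prop) p hp
    rw [mixedDeriv_mul hO hT₂ hT₂ hp, mixedDeriv_mul isOpen_univ hsnd hsnd (Set.mem_univ _),
      m2 p hp] at this
    simp [mixedDeriv, derivFst, derivSnd, hzw p hp] at this ⊢
    grind
  have h12 : ∀ p ∈ O, (derivFst T₁ p * derivSnd T₂ p + derivFst T₂ p * derivSnd T₁ p)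
      * (1 - p.1 * p.2) ^ 2 = (1 - T₁ p * T₂ p) ^ 2 := fun p hp => by
    have := hinv (fun q => q.1 * q.2) (by fun_prop) p hp
    rw [mixedDeriv_mul hO hT₁ hT₂ hp, mixedDeriv_mul isOpen_univ hfst hsnd (Set.mem_univ _),
      m1 p hp, m2 p hp] at this
    have e : mixedDeriv (fun q => q.1) (T₁ p, T₂ p) * T₂ p
        + derivSnd (fun q => q.1) (T₁ p, T₂ p) * derivFst (fun q => q.2) (T₁ p, T₂ p)
        + (derivFst (fun q => q.1) (T₁ p, T₂ p) * derivSnd (fun q => q.2) (T₁ p, T₂ p)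
        + T₁ p * mixedDeriv (fun q => q.2) (T₁ p, T₂ p)) = 1 := by
      simp [mixedDeriv, derivFst, derivSnd]
    rw [e] at this
    linear_combination this
  have hne : ∀ p ∈ O, derivFst T₁ p * derivSnd T₂ p + derivFst T₂ p * derivSnd T₁ p ≠ 0 :=
    fun p hp h0 => by
      have := h12 p hp
      rw [h0, zero_mul] at this
      exact pow_ne_zero 2 (hTT p hp) this.symm
  have hopen : ∀ f : ℂ × ℂ → ℂ, DifferentiableOn ℂ f O →
      IsOpen (O ∩ derivSnd f ⁻¹' {0}ᶜ) := fun f hf =>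
    ContinuousOn.isOpen_inter_preimage
      (fun p hp => (continuousAt_derivSnd hO hf hp).continuousWithinAt) hO isOpen_compl_singleton
  have hdisj : Disjoint (O ∩ derivSnd T₁ ⁻¹' {0}ᶜ) (O ∩ derivSnd T₂ ⁻¹' {0}ᶜ) := by
    rw [Set.disjoint_left]
    rintro p ⟨hp, h1⟩ ⟨-, h2⟩
    have h1 : derivSnd T₁ p ≠ 0 := h1
    have h2 : derivSnd T₂ p ≠ 0 := h2
    refine hne p hp ?_
    rw [(mul_eq_zero.1 (h11 p hp)).resolve_left h1, (mul_eq_zero.1 (h22 p hp)).resolve_left h2,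
      zero_mul, zero_mul, add_zero]
  have hcover : O ⊆ (O ∩ derivSnd T₁ ⁻¹' {0}ᶜ) ∪ (O ∩ derivSnd T₂ ⁻¹' {0}ᶜ) := by
    intro p hp
    by_contra hc
    simp only [Set.mem_union, Set.mem_inter_iff, hp, true_and, Set.mem_preimage,
      Set.mem_compl_iff, Set.mem_singleton_iff, not_or, not_not] at hc
    exact hne p hp (by rw [hc.1, hc.2, mul_zero, mul_zero, add_zero])
  rcases hOc.isPreconnected.subset_or_subset (hopen T₁ hT₁) (hopen T₂ hT₂) hdisj hcover
    with hsub | hsub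
  · have hw1 : ∀ p ∈ O, derivSnd T₁ p ≠ 0 := fun p hp => (hsub hp).2
    have hz1 : ∀ p ∈ O, derivFst T₁ p = 0 := fun p hp =>
      (mul_eq_zero.1 (h11 p hp)).resolve_left (hw1 p hp)
    have hw2 : ∀ p ∈ O, derivSnd T₂ p = 0 := fun p hp =>
      (mul_eq_zero.1 (h22 p hp)).resolve_right fun h0 => hne p hp (by simp [hz1 p hp, h0])
    obtain ⟨a, b, c, d, hdet, h⟩ := exists_moebius_of_derivSnd_eq_zero hO hOc hOΩ hT₂ hT₁
      (fun p hp => by simpa only [mul_comm] using hTT p hp) hw2 hz1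
      (fun p hp => by
        have := h12 p hp
        rw [hz1 p hp, zero_mul, zero_add] at this
        rw [this, mul_comm (T₁ p)])
    refine ⟨d, c, b, a, by convert hdet using 1; ring, Or.inr fun p hp => ?_⟩
    obtain ⟨⟨h1, h2⟩, h3, h4⟩ := h p hp
    exact ⟨⟨h2, h1⟩, h4, h3⟩
  · have hw2 : ∀ p ∈ O, derivSnd T₂ p ≠ 0 := fun p hp => (hsub hp).2
    have hz2 : ∀ p ∈ O, derivFst T₂ p = 0 := fun p hp =>
      (mul_eq_zero.1 (h22 p hp)).resolve_left (hw2 p hp)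
    have hw1 : ∀ p ∈ O, derivSnd T₁ p = 0 := fun p hp =>
      (mul_eq_zero.1 (h11 p hp)).resolve_right fun h0 => hne p hp (by simp [hz2 p hp, h0])
    obtain ⟨a, b, c, d, hdet, h⟩ := exists_moebius_of_derivSnd_eq_zero hO hOc hOΩ hT₁ hT₂
      hTT hw1 hz2
      (fun p hp => by
        have := h12 p hp
        rwa [hz2 p hp, zero_mul, add_zero] at this)
    exact ⟨a, b, c, d, hdet, Or.inl h⟩
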